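/- arXiv:0812.2579 — 2 statements merged into one kernel-verified Lean document; each statement's English description precedes it below -/
import Mathlib

section
/- Let the points be the 2-element subsets of {1,2,…,8}, let M = {{1,2},{3,4},{5,6},{7,8}}, and call two distinct points a, b adjacent if either (both a,b ∈ M or both a,b ∉ M) and a ∩ b = ∅, or (exactly one of a,b lies in M) and a ∩ b ≠ ∅. Call a tetrahedron any 4-element set of points that are pairwise adjacent. Then the number of tetrahedra containing the point {1,2} is exactly 7. -/
/-- The points: the 28 two-element subsets of `{1, 2, …, 8}`. -/
def Pts : Finset (Finset ℕ) := (Finset.Icc 1 8).powersetCard 2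

/-- The distinguished perfect matching `M = {{1,2},{3,4},{5,6},{7,8}}`. -/
def M : Finset (Finset ℕ) := {{1, 2}, {3, 4}, {5, 6}, {7, 8}}

/-- Two distinct points `a, b` are adjacent if either both or neither lie in `M` and
`a ∩ b = ∅`, or exactly one of them lies in `M` and `a ∩ b ≠ ∅`. -/
def Adj (a b : Finset ℕ) : Prop :=
  a ≠ b ∧ (((a ∈ M ↔ b ∈ M) ∧ a ∩ b = ∅) ∨ (¬(a ∈ M ↔ b ∈ M) ∧ (a ∩ b).Nonempty))

instance : DecidableRel Adj := fun a b => by unfold Adj; infer_instance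

/-- The points adjacent to the distinguished point `{1, 2}`. -/
def nbrs : Finset (Finset ℕ) := Pts.filter (fun a => Adj {1, 2} a)

/-- The triples of neighbours of `{1, 2}` that are pairwise adjacent. -/
def triples : Finset (Finset (Finset ℕ)) :=
  (nbrs.powersetCard 3).filter (fun S => ∀ a ∈ S, ∀ b ∈ S, a ≠ b → Adj a b)

theorem card_triples : triples.card = 7 := by decide +kernel

theorem Adj.symm' {a b : Finset ℕ} (h : Adj a b) : Adj b a := by
  unfold Adj at *
  rw [Finset.inter_comm b a, iff_comm (a := b ∈ M)]
  exact ⟨h.1.symm, h.2⟩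

theorem not_mem_nbrs : ({1, 2} : Finset ℕ) ∉ nbrs := by
  intro h
  exact (Finset.mem_filter.1 h).2.1 rfl

theorem base_mem_pts : ({1, 2} : Finset ℕ) ∈ Pts := by decide +kernel

/-- The number of tetrahedra (4-element sets of pairwise adjacent points) containing the
distinguished point `{1, 2}` is exactly 7. -/
theorem card_tetrahedra_through_distinguished_point :
    ((Pts.powersetCard 4).filter
      (fun T => ({1, 2} : Finset ℕ) ∈ T ∧ ∀ a ∈ T, ∀ b ∈ T, a ≠ b → Adj a b)).card = 7 := by
  rw [← card_triples]
  have hn := not_mem_nbrs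
  have hp := base_mem_pts
  generalize hq : ({1, 2} : Finset ℕ) = p at *
  have hN : ∀ a, a ∈ nbrs ↔ a ∈ Pts ∧ Adj p a := by
    intro a
    rw [← hq]
    exact Finset.mem_filter
  refine Finset.card_bij' (fun T _ => T.erase p) (fun S _ => insert p S) ?_ ?_ ?_ ?_
  · intro T hT
    obtain ⟨hT1, hpT, hT2⟩ := Finset.mem_filter.1 hT
    obtain ⟨hsub, hcard⟩ := Finset.mem_powersetCard.1 hT1
    refine Finset.mem_filter.2 ⟨Finset.mem_powersetCard.2 ⟨?_, ?_⟩, ?_⟩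
    · intro a ha
      obtain ⟨h1, h2⟩ := Finset.mem_erase.1 ha
      exact (hN a).2 ⟨hsub h2, hT2 p hpT a h2 h1.symm⟩
    · rw [Finset.card_erase_of_mem hpT, hcard]
    · intro a ha b hb
      exact hT2 a (Finset.mem_of_mem_erase ha) b (Finset.mem_of_mem_erase hb)
  · intro S hS
    obtain ⟨hS1, hS2⟩ := Finset.mem_filter.1 hS
    obtain ⟨hsub, hcard⟩ := Finset.mem_powersetCard.1 hS1
    refine Finset.mem_filter.2 ⟨Finset.mem_powersetCard.2 ⟨?_, ?_⟩,
      Finset.mem_insert_self _ _, ?_⟩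
    · intro a ha
      rcases Finset.mem_insert.1 ha with rfl | ha
      · exact hp
      · exact ((hN a).1 (hsub ha)).1
    · rw [Finset.card_insert_of_notMem (fun h => hn (hsub h)), hcard]
    · intro a ha b hb hab
      rcases Finset.mem_insert.1 ha with h1 | h1 <;> rcases Finset.mem_insert.1 hb with h2 | h2
      · exact absurd (h1.trans h2.symm) hab
      · rw [h1]
        exact ((hN b).1 (hsub h2)).2
      · rw [h2]
        exact ((hN a).1 (hsub h1)).2.symm'
      · exact hS2 a h1 b h2 hab
  · intro T hT
    exact Finset.insert_erase (Finset.mem_filter.1 hT).2.1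
  · intro S hS
    have hsub := (Finset.mem_powersetCard.1 (Finset.mem_filter.1 hS).1).1
    exact Finset.erase_insert (fun h => hn (hsub h))
end

section
/- Let C ⊂ ℝ^n be a locally finite set (every bounded subset of ℝ^n contains only finitely many points of C). Suppose C is group-balanced: for every x ∈ C, every point of ℝ^n fixed by all isometries g of ℝ^n with g(C) = C and g(x) = x is equal to x. Then C is balanced: for every x ∈ C and every d > 0, the set {y ∈ C : ‖x - y‖ = d} is either empty or has centroid x. -/
/-- A locally finite, group-balanced subset `C` of Euclidean space is balanced.
Group-balanced means: for every `x ∈ C`, the only point of `ℝ^n` fixed by every isometry of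
`ℝ^n` that preserves `C` and fixes `x` is `x` itself.  Balanced means: for every `x ∈ C` and
every `d > 0`, the set `{y ∈ C : ‖x - y‖ = d}` is either empty or has centroid `x`. -/
theorem euclidean_balanced_of_groupBalanced
    (n : ℕ) (C : Set (EuclideanSpace ℝ (Fin n)))
    (hlf : ∀ B : Set (EuclideanSpace ℝ (Fin n)), Bornology.IsBounded B → (C ∩ B).Finite)
    (hgb : ∀ x ∈ C, ∀ v : EuclideanSpace ℝ (Fin n),
      (∀ g : EuclideanSpace ℝ (Fin n) ≃ᵢ EuclideanSpace ℝ (Fin n),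
        g '' C = C → g x = x → g v = v) → v = x) :
    ∀ x ∈ C, ∀ d : ℝ, 0 < d →
      ∃ hfin : {y ∈ C | ‖x - y‖ = d}.Finite,
        {y ∈ C | ‖x - y‖ = d}.Nonempty →
          (hfin.toFinset.card : ℝ)⁻¹ • ∑ y ∈ hfin.toFinset, y = x := by
  intro x hx d hd
  have hfin : {y ∈ C | ‖x - y‖ = d}.Finite := by
    refine (hlf (Metric.sphere x d) Metric.isBounded_sphere).subset ?_
    rintro y ⟨hy, hyd⟩
    refine ⟨hy, ?_⟩
    rw [mem_sphere_iff_norm, norm_sub_rev]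
    exact hyd
  refine ⟨hfin, fun hne => ?_⟩
  apply hgb x hx
  intro g hgC hgx
  have hcard : (hfin.toFinset.card : ℝ) ≠ 0 := by
    have : hfin.toFinset.Nonempty := by simpa using hne
    exact_mod_cast this.card_pos.ne'
  have hL : ∀ z, g z = g.toRealAffineIsometryEquiv.linearIsometryEquiv (z - x) + x := by
    intro z
    have h := g.toRealAffineIsometryEquiv.map_vsub z x
    rw [vsub_eq_sub, vsub_eq_sub] at h
    rw [h]
    simp [hgx]
  generalize g.toRealAffineIsometryEquiv.linearIsometryEquiv = L at hL
  have hsum : ∑ y ∈ hfin.toFinset, g y = ∑ y ∈ hfin.toFinset, y := by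
    refine Finset.sum_bij (fun y _ => g y) ?_ ?_ ?_ ?_
    · intro y hy
      rw [Set.Finite.mem_toFinset] at hy ⊢
      refine ⟨hgC ▸ Set.mem_image_of_mem g hy.1, ?_⟩
      have := g.dist_eq x y
      rw [hgx, dist_eq_norm, dist_eq_norm] at this
      rw [this]
      exact hy.2
    · intro a _ b _ h
      exact g.injective h
    · intro b hb
      rw [Set.Finite.mem_toFinset] at hb
      have hb1 : b ∈ g '' C := hgC.symm ▸ hb.1
      obtain ⟨a, ha, rfl⟩ := hb1
      refine ⟨a, ?_, rfl⟩
      rw [Set.Finite.mem_toFinset]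
      refine ⟨ha, ?_⟩
      have := g.dist_eq x a
      rw [hgx, dist_eq_norm, dist_eq_norm] at this
      rw [← this]
      exact hb.2
    · intro a _
      rfl
  have hv : ∀ f : EuclideanSpace ℝ (Fin n) → EuclideanSpace ℝ (Fin n),
      (hfin.toFinset.card : ℝ)⁻¹ • ∑ y ∈ hfin.toFinset, f y - x
        = (hfin.toFinset.card : ℝ)⁻¹ • ∑ y ∈ hfin.toFinset, (f y - x) := by
    intro f
    rw [Finset.sum_sub_distrib, Finset.sum_const, ← Nat.cast_smul_eq_nsmul ℝ, smul_sub,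
      inv_smul_smul₀ hcard]
  have hLg : ∀ y, L (y - x) = g y - x := fun y => by rw [hL y]; simp
  rw [hL, hv (fun y => y), map_smul, map_sum]
  simp only [hLg]
  rw [← hv, hsum]
  simp
end
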